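/- arXiv:0706.2902 — 9 statements merged into one kernel-verified Lean document; each statement's English description precedes it below -/
import Mathlib

section
/- Let A1 and A12 be real n×n matrices and Γ a real N×N matrix. Then the real matrix I_N ⊗ A1 + Γ ⊗ A12 is Hurwitz if and only if, for every eigenvalue λ ∈ ℂ of Γ, the complex matrix A1 + λ·A12 is Hurwitz. -/
open Matrix Kronecker

/-- A complex square matrix is Hurwitz (stable) if every eigenvalue has negative real part. -/
def IsHurwitz {ι : Type*} [Fintype ι] [DecidableEq ι] (M : Matrix ι ι ℂ) : Prop :=
  ∀ μ ∈ spectrum ℂ M, μ.re < 0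

theorem Matrix.mem_spectrum_iff_exists_mulVec_eq_smul {K ι : Type*} [Field K] [Fintype ι]
    [DecidableEq ι] {M : Matrix ι ι K} {μ : K} :
    μ ∈ spectrum K M ↔ ∃ v : ι → K, v ≠ 0 ∧ M *ᵥ v = μ • v := by
  rw [← Matrix.spectrum_toLin', ← Module.End.hasEigenvalue_iff_mem_spectrum]
  constructor
  · intro h
    obtain ⟨v, hv⟩ := h.exists_hasEigenvector
    exact ⟨v, hv.2, by simpa using hv.apply_eq_smul⟩
  · rintro ⟨v, hv, h⟩
    exact Module.End.hasEigenvalue_of_hasEigenvector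
      ⟨Module.End.mem_eigenspace_iff.2 (by simpa using h), hv⟩

/-- An endomorphism commuting with `f` has an eigenvector inside each eigenspace of `f`. -/
theorem Module.End.exists_common_eigenvector_of_commute {K V : Type*} [Field K] [IsAlgClosed K]
    [AddCommGroup V] [Module K V] [FiniteDimensional K V] {f g : Module.End K V}
    (hfg : Commute f g) {μ : K} {v : V} (hv : v ≠ 0) (hf : f v = μ • v) :
    ∃ (ν : K) (w : V), w ≠ 0 ∧ f w = μ • w ∧ g w = ν • w := by
  have hmaps : ∀ x ∈ f.eigenspace μ, g x ∈ f.eigenspace μ := by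
    intro x hx
    rw [Module.End.mem_eigenspace_iff] at hx ⊢
    rw [← Module.End.mul_apply, hfg.eq, Module.End.mul_apply, hx, map_smul]
  have : Nontrivial (f.eigenspace μ) :=
    ⟨⟨v, Module.End.mem_eigenspace_iff.2 hf⟩, 0, fun h => hv (congrArg Subtype.val h)⟩
  obtain ⟨ν, hν⟩ := Module.End.exists_eigenvalue (g.restrict hmaps)
  obtain ⟨w, hw⟩ := hν.exists_hasEigenvector
  exact ⟨ν, w, fun h => hw.2 (Subtype.ext h), Module.End.mem_eigenspace_iff.1 w.2,
    congrArg Subtype.val hw.apply_eq_smul⟩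

/-- The spectrum of `1 ⊗ₖ A + G ⊗ₖ B` is the union of the spectra of `A + μ • B`, with `μ` running
over the spectrum of `G`. -/
theorem Matrix.mem_spectrum_one_kronecker_add_kronecker_iff {K m n : Type*} [Field K]
    [IsAlgClosed K] [Fintype m] [DecidableEq m] [Fintype n] [DecidableEq n]
    {A B : Matrix n n K} {G : Matrix m m K} {ν : K} :
    ν ∈ spectrum K ((1 : Matrix m m K) ⊗ₖ A + G ⊗ₖ B) ↔
      ∃ μ ∈ spectrum K G, ν ∈ spectrum K (A + μ • B) := by
  simp only [Matrix.mem_spectrum_iff_exists_mulVec_eq_smul]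
  constructor
  · rintro ⟨v, hv, h⟩
    have hcomm : Commute (Matrix.toLin' ((1 : Matrix m m K) ⊗ₖ A + G ⊗ₖ B))
        (Matrix.toLin' (G ⊗ₖ (1 : Matrix n n K))) := by
      simp only [Commute, SemiconjBy, Module.End.mul_eq_comp, ← Matrix.toLin'_mul, add_mul,
        mul_add, ← Matrix.mul_kronecker_mul, one_mul, mul_one]
    obtain ⟨μ, w, hw, hM, hG⟩ := Module.End.exists_common_eigenvector_of_commute hcomm hv
      ((Matrix.toLin'_apply _ v).trans h)
    obtain ⟨X, rfl⟩ : ∃ X : Matrix n m K, X.vec = w := ⟨Matrix.of fun j i => w (i, j), rfl⟩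
    simp only [Matrix.toLin'_apply, Matrix.add_mulVec, Matrix.kronecker_mulVec_vec,
      ← Matrix.vec_smul, ← Matrix.vec_add, Matrix.vec_inj, transpose_one, Matrix.one_mul,
      Matrix.mul_one] at hM hG
    rw [Matrix.mul_assoc, hG] at hM
    obtain ⟨j, i, hij⟩ : ∃ j i, X j i ≠ 0 := by
      by_contra! hX
      exact hw (funext fun p => hX p.2 p.1)
    refine ⟨μ, ⟨X j, fun h0 => hij (congrFun h0 i), ?_⟩, X.col i,
      fun h0 => hij (congrFun h0 j), ?_⟩
    · ext k
      simpa [Matrix.mul_apply, Matrix.mulVec, dotProduct, mul_comm] using congrFun (congrFun hG j) k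
    · rw [Matrix.mul_smul, ← Matrix.smul_mul, ← Matrix.add_mul] at hM
      ext k
      exact congrFun (congrFun hM k) i
  · rintro ⟨μ, ⟨u, hu, hGu⟩, v, hv, hAv⟩
    refine ⟨(Matrix.vecMulVec v u).vec, ?_, ?_⟩
    · obtain ⟨i, hi⟩ := Function.ne_iff.1 hu
      obtain ⟨j, hj⟩ := Function.ne_iff.1 hv
      exact Function.ne_iff.2 ⟨(i, j), mul_ne_zero hj hi⟩
    · rw [Matrix.add_mulVec, Matrix.kronecker_mulVec_vec, Matrix.kronecker_mulVec_vec,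
        ← Matrix.vec_smul, ← Matrix.vec_add, Matrix.vec_inj, transpose_one, Matrix.mul_one,
        Matrix.mul_assoc, Matrix.vecMulVec_mul, Matrix.vecMul_transpose, hGu,
        Matrix.vecMulVec_smul, Matrix.mul_smul, ← Matrix.smul_mul, ← Matrix.add_mul,
        Matrix.mul_vecMulVec, hAv, Matrix.smul_vecMulVec]

/-- The real matrix `I_N ⊗ A1 + Γ ⊗ A12` is Hurwitz iff for every eigenvalue `λ ∈ ℂ` of `Γ`,
the complex matrix `A1 + λ • A12` is Hurwitz. -/
theorem kronecker_network_hurwitz_iff (n N : ℕ)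
    (A1 A12 : Matrix (Fin n) (Fin n) ℝ) (Γ : Matrix (Fin N) (Fin N) ℝ) :
    IsHurwitz (((1 : Matrix (Fin N) (Fin N) ℝ) ⊗ₖ A1 + Γ ⊗ₖ A12).map Complex.ofReal) ↔
      ∀ μ ∈ spectrum ℂ (Γ.map Complex.ofReal),
        IsHurwitz (A1.map Complex.ofReal + μ • A12.map Complex.ofReal) := by
  have hmap : ((1 : Matrix (Fin N) (Fin N) ℝ) ⊗ₖ A1 + Γ ⊗ₖ A12).map Complex.ofReal =
      (1 : Matrix (Fin N) (Fin N) ℂ) ⊗ₖ A1.map Complex.ofReal +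
        Γ.map Complex.ofReal ⊗ₖ A12.map Complex.ofReal := by
    ext ⟨i, j⟩ ⟨k, l⟩
    by_cases h : i = k <;> simp [h]
  simp only [IsHurwitz, hmap, Matrix.mem_spectrum_one_kronecker_add_kronecker_iff]
  exact ⟨fun h μ hμ ν hν => h ν ⟨μ, hμ, hν⟩, fun h ν ⟨μ, hμ, hν⟩ => h μ hμ ν hν⟩
end

section
/- Let N ≥ 2 be even. Then there exists an invertible real N×N matrix T such that T⁻¹ Γ T = Λ_N, where Λ_N = diag(−I_{N/2}, J_{N/2}). In particular, Γ is similar to Λ_N. -/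
open Matrix

/-- The outer coupling matrix `Γ` (1-indexed entries `γ_{ij}`: `γ_{ii} = 0`; for `i > j`,
`γ_{ij} = −1` if `j ≤ i−2` and `j` is odd, `γ_{ij} = 1` otherwise; `γ_{ij} = 1` for `i < j`).
Here indices are 0-based, so "`j` odd (1-indexed)" becomes "`j` even (0-indexed)" and
"`j ≤ i − 2` (1-indexed)" becomes "`j + 2 ≤ i` (0-indexed)". -/
def Gam (N : ℕ) : Matrix (Fin N) (Fin N) ℝ :=
  Matrix.of fun i j =>
    if i = j then 0
    else if j.1 + 2 ≤ i.1 ∧ j.1 % 2 = 0 then -1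
    else 1

/-- `Λ_N = diag(−I_{N/2}, J_{N/2})`, where `J_m` is the `m × m` upper bidiagonal matrix with
diagonal entries `1` and superdiagonal entries `2`. -/
def LambdaMat (N : ℕ) : Matrix (Fin N) (Fin N) ℝ :=
  Matrix.of fun i j =>
    if i.1 < N / 2 then (if i = j then -1 else 0)
    else if j.1 < N / 2 then 0
    else if i = j then 1
    else if j.1 = i.1 + 1 then 2
    else 0

/-- The Jordan chain `f₀, f₁, …` of `v ↦ (i ↦ ∑ j > i, v j)`, normalised by `f₀ = δ₀`. -/
def chainVec : ℕ → ℕ → ℝ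
  | 0, 0 => 1
  | 0, _ + 1 => 0
  | _ + 1, 0 => 0
  | k + 1, i + 1 => chainVec k i - chainVec k (i + 1)

lemma chainVec_of_lt {k i : ℕ} (h : k < i) : chainVec k i = 0 := by
  induction k generalizing i with
  | zero => obtain ⟨i, rfl⟩ := Nat.exists_eq_succ_of_ne_zero h.ne'; rfl
  | succ k ih =>
    obtain ⟨i, rfl⟩ := Nat.exists_eq_succ_of_ne_zero (Nat.ne_zero_of_lt h)
    simp [chainVec, ih (Nat.lt_of_succ_lt_succ h), ih (show k < i + 1 by omega)]

lemma chainVec_self (k : ℕ) : chainVec k k = 1 := by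
  induction k with
  | zero => rfl
  | succ k ih => simp [chainVec, ih, chainVec_of_lt]

lemma sum_Ico_chainVec_zero {i M : ℕ} (hi : i < M) :
    ∑ m ∈ Finset.Ico i M, chainVec 0 m = chainVec 0 i := by
  rw [Finset.sum_eq_single_of_mem i (by simp [hi])]
  intro m hm hne
  exact chainVec_of_lt (by simp at hm; omega)

lemma sum_Ico_chainVec_succ {k i M : ℕ} (hi : i ≤ M) (hk : k + 1 < M) :
    ∑ m ∈ Finset.Ico i M, chainVec (k + 1) m = chainVec (k + 1) i + chainVec k i := by
  have h := Finset.sum_Ico_sub (fun m => -(chainVec (k + 1) m + chainVec k m)) hi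
  rw [chainVec_of_lt hk, chainVec_of_lt (show k < M by omega)] at h
  rw [show chainVec (k + 1) i + chainVec k i = -(0 + 0) - -(chainVec (k + 1) i + chainVec k i) by
    ring, ← h]
  refine Finset.sum_congr rfl fun m _ => ?_
  simp only [chainVec]
  ring

lemma sum_fin_add_self (M : ℕ) (F : ℕ → ℝ) :
    ∑ l : Fin (M + M), F l = ∑ k ∈ Finset.range M, (F (2 * k) + F (2 * k + 1)) := by
  rw [Fin.sum_univ_eq_sum_range, ← two_mul]
  induction M with
  | zero => simp
  | succ M ih =>
    rw [Finset.sum_range_succ _ M, ← ih, show 2 * (M + 1) = 2 * M + 1 + 1 by ring,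
      Finset.sum_range_succ, Finset.sum_range_succ, add_assoc]

/-- The first `M` columns span the kernel of `Γ + 1`, the last `M` form a Jordan chain of `Γ`
for the eigenvalue `1`. -/
def gamBasis (M : ℕ) : Matrix (Fin (M + M)) (Fin (M + M)) ℝ :=
  Matrix.of fun i j =>
    if j.1 < M then
      (if i.1 = 2 * j.1 + 1 then 1 else 0) - (if i.1 + 2 = M + M then 1 else 0)
    else chainVec (j.1 - M) (i.1 / 2)

lemma gam_mulVec_add (M : ℕ) (v : ℕ → ℝ) (i : Fin (M + M)) :
    (Gam (M + M) *ᵥ fun l => v l) i + v i =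
      ∑ k ∈ Finset.range M, ((if k < i.1 / 2 then -1 else 1) * v (2 * k) + v (2 * k + 1)) := by
  have h := sum_fin_add_self M fun l => (if l + 2 ≤ i.1 ∧ l % 2 = 0 then -1 else 1) * v l
  have hv : v i = ∑ l : Fin (M + M), if i = l then v l else 0 := by simp
  rw [hv, mulVec, dotProduct, ← Finset.sum_add_distrib]
  convert h using 2 with l _ k _
  · simp only [Gam, of_apply]
    by_cases hil : i = l
    · subst hil; simp
    · simp [hil]
  · have h₁ : (2 * k + 2 ≤ i.1 ∧ 2 * k % 2 = 0) ↔ k < i.1 / 2 := by omega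
    have h₂ : ¬ (2 * k + 1 + 2 ≤ i.1 ∧ (2 * k + 1) % 2 = 0) := by omega
    simp only [h₁, h₂, if_false, one_mul]

lemma gam_mul_gamBasis_castAdd (M : ℕ) (i : Fin (M + M)) (j : Fin M) :
    (Gam (M + M) * gamBasis M) i (Fin.castAdd M j) = -gamBasis M i (Fin.castAdd M j) := by
  have h := gam_mulVec_add M (fun i => (if i = 2 * j.1 + 1 then 1 else 0) -
    (if i + 2 = M + M then 1 else 0)) i
  have hsum : ∑ k ∈ Finset.range M, ((if k < i.1 / 2 then (-1 : ℝ) else 1) *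
      ((if 2 * k = 2 * j.1 + 1 then 1 else 0) - (if 2 * k + 2 = M + M then 1 else 0)) +
      ((if 2 * k + 1 = 2 * j.1 + 1 then 1 else 0) -
        (if 2 * k + 1 + 2 = M + M then 1 else 0))) = 0 := by
    have hk : ∀ k ∈ Finset.range M, ((if k < i.1 / 2 then (-1 : ℝ) else 1) *
      ((if 2 * k = 2 * j.1 + 1 then 1 else 0) - (if 2 * k + 2 = M + M then 1 else 0)) +
      ((if 2 * k + 1 = 2 * j.1 + 1 then 1 else 0) -
        (if 2 * k + 1 + 2 = M + M then 1 else 0))) =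
        (if k = j.1 then 1 else 0) - (if k = M - 1 then 1 else 0) := by
      intro k hk
      have hk' := Finset.mem_range.1 hk
      have h₁ : ¬ 2 * k = 2 * j.1 + 1 := by omega
      have h₂ : ¬ 2 * k + 1 + 2 = M + M := by omega
      have h₃ : 2 * k + 2 = M + M ↔ k = M - 1 := by omega
      have h₄ : 2 * k + 1 = 2 * j.1 + 1 ↔ k = j.1 := by omega
      simp only [h₁, h₂, h₃, h₄, if_false]
      by_cases h₅ : k = M - 1
      · have h₆ : ¬ k < i.1 / 2 := by omega
        rw [if_neg h₆, if_pos h₅]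
        ring
      · simp [h₅]
    rw [Finset.sum_congr rfl hk, Finset.sum_sub_distrib]
    have hM : 0 < M := j.pos
    simp [hM]
  rw [hsum] at h
  have h' := eq_neg_of_add_eq_zero_left h
  simpa [Matrix.mul_apply, mulVec, dotProduct, gamBasis] using h'

lemma gam_mul_gamBasis_natAdd (M : ℕ) (i : Fin (M + M)) (j : Fin M) :
    (Gam (M + M) * gamBasis M) i (Fin.natAdd M j) + chainVec j (i / 2) =
      2 * ∑ m ∈ Finset.Ico (i.1 / 2) M, chainVec j m := by
  have h := gam_mulVec_add M (fun i => chainVec j (i / 2)) i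
  have hsum : ∑ k ∈ Finset.range M, ((if k < i.1 / 2 then (-1 : ℝ) else 1) *
      chainVec j (2 * k / 2) + chainVec j ((2 * k + 1) / 2)) =
      2 * ∑ m ∈ Finset.Ico (i.1 / 2) M, chainVec j m := by
    rw [← Finset.sum_range_add_sum_Ico _ (show i.1 / 2 ≤ M by omega), Finset.mul_sum,
      Finset.sum_eq_zero, zero_add]
    · refine Finset.sum_congr rfl fun k hk => ?_
      have h₁ : ¬ k < i.1 / 2 := by simp at hk; omega
      rw [if_neg h₁, show 2 * k / 2 = k by omega, show (2 * k + 1) / 2 = k by omega]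
      ring
    · intro k hk
      rw [if_pos (Finset.mem_range.1 hk), show 2 * k / 2 = k by omega,
        show (2 * k + 1) / 2 = k by omega]
      ring
  rw [hsum] at h
  simpa [Matrix.mul_apply, mulVec, dotProduct, gamBasis] using h

lemma gam_mul_gamBasis (M : ℕ) :
    Gam (M + M) * gamBasis M = gamBasis M * LambdaMat (M + M) := by
  have hM : (M + M) / 2 = M := by omega
  ext i j
  induction j using Fin.addCases with
  | left j =>
    rw [gam_mul_gamBasis_castAdd, Matrix.mul_apply, Fin.sum_univ_add]
    simp [LambdaMat, hM]
  | right j =>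
    have h := gam_mul_gamBasis_natAdd M i j
    have hi : i.1 / 2 < M := by omega
    rw [Matrix.mul_apply (M := gamBasis M), Fin.sum_univ_add]
    have h₁ : ∀ k : Fin M, LambdaMat (M + M) (Fin.castAdd M k) (Fin.natAdd M j) = 0 := by
      intro k
      have : Fin.castAdd M k ≠ Fin.natAdd M j := by
        intro h; have := congrArg Fin.val h; simp at this; omega
      simp only [LambdaMat, of_apply, hM, Fin.val_castAdd, k.2, if_true, if_neg this]
    have h₂ : ∀ k : Fin M, LambdaMat (M + M) (Fin.natAdd M k) (Fin.natAdd M j) =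
        (if k = j then 1 else 0) + (if j.1 = k.1 + 1 then 2 else 0) := by
      intro k
      have h₃ : j.1 + M = k.1 + M + 1 ↔ j.1 = k.1 + 1 := by omega
      by_cases hkj : k = j
      · simp [LambdaMat, hM, hkj]
      · simp [LambdaMat, hM, hkj, h₃]
    simp only [h₁, h₂, mul_zero, Finset.sum_const_zero, zero_add, mul_add,
      Finset.sum_add_distrib]
    have h₄ : ∀ k : Fin M, gamBasis M i (Fin.natAdd M k) = chainVec k (i / 2) := by
      intro k; simp [gamBasis]
    simp only [h₄]
    obtain ⟨j, hj⟩ := j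
    cases j with
    | zero =>
      simp only [sum_Ico_chainVec_zero hi] at h
      rw [eq_sub_of_add_eq h]
      simp
      ring
    | succ j =>
      simp only [sum_Ico_chainVec_succ hi.le hj] at h
      rw [eq_sub_of_add_eq h, Finset.sum_eq_single (⟨j, by omega⟩ : Fin M) (f := fun k : Fin M =>
        chainVec k (i / 2) * if j + 1 = k.1 + 1 then 2 else 0)]
      · simp
        ring
      · intro k _ hk
        have : ¬ j = k.1 := fun h => hk (Fin.ext h.symm)
        simp [this]
      · simp

lemma eq_zero_of_sum_chainVec_eq_zero {M : ℕ} (w : Fin M → ℝ)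
    (h : ∀ m < M, ∑ k : Fin M, chainVec k m * w k = 0) : w = 0 := by
  let U : Matrix (Fin M) (Fin M) ℝ := Matrix.of fun m k => chainVec k m
  have hU : U.BlockTriangular id := fun m k hkm => chainVec_of_lt hkm
  have hdet : U.det = 1 := by
    rw [Matrix.det_of_isUpperTriangular hU]
    simp [U, chainVec_self]
  exact Matrix.eq_zero_of_mulVec_eq_zero (M := U) (by simp [hdet])
    (funext fun m => h m m.2)

lemma isUnit_det_gamBasis (M : ℕ) : IsUnit (gamBasis M).det := by
  rw [isUnit_iff_ne_zero]
  intro hdet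
  obtain ⟨w, hw, h⟩ := Matrix.exists_mulVec_eq_zero_iff.2 hdet
  apply hw
  set g : ℕ → ℝ := fun m => ∑ k : Fin M, chainVec k m * w (Fin.natAdd M k) with hg
  have row : ∀ i : Fin (M + M),
      (∑ k : Fin M, ((if i.1 = 2 * k.1 + 1 then 1 else 0) -
        (if i.1 + 2 = M + M then 1 else 0)) * w (Fin.castAdd M k)) + g (i / 2) = 0 := by
    intro i
    have := congrFun h i
    rw [mulVec, dotProduct, Fin.sum_univ_add] at this
    simpa [gamBasis, hg] using this
  have odd_row : ∀ m : Fin M, w (Fin.castAdd M m) + g m = 0 := by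
    intro m
    have := row ⟨2 * m + 1, by omega⟩
    have h₁ : ¬ 2 * m.1 + 1 + 2 = M + M := by omega
    simpa [h₁, show (2 * m.1 + 1) / 2 = m by omega, Fin.val_inj] using this
  have even_row : ∀ m : Fin M, m.1 + 1 < M → g m = 0 := by
    intro m hm
    have := row ⟨2 * m, by omega⟩
    have h₁ : ¬ 2 * m.1 + 2 = M + M := by omega
    have h₂ : ∀ k : Fin M, ¬ 2 * m.1 = 2 * k.1 + 1 := by omega
    simpa [h₁, h₂] using this
  have last_row : ∀ m : Fin M, m.1 + 1 = M → g m = 0 := by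
    intro m hm
    have h₀ := row ⟨2 * m, by omega⟩
    have h₁ : 2 * m.1 + 2 = M + M := by omega
    have h₂ : ∀ k : Fin M, ¬ 2 * m.1 = 2 * k.1 + 1 := by omega
    have h₃ : ∑ k : Fin M, w (Fin.castAdd M k) = w (Fin.castAdd M m) := by
      refine Finset.sum_eq_single_of_mem m (Finset.mem_univ _) fun k _ hk => ?_
      have hk' : k.1 ≠ m.1 := fun h => hk (Fin.ext h)
      have := odd_row k
      rw [even_row k (by omega)] at this
      simpa using this
    simp [h₁, h₂, h₃] at h₀
    linarith [odd_row m]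
  have hg0 : ∀ m : Fin M, g m = 0 := fun m =>
    (Nat.lt_or_eq_of_le (Nat.succ_le_of_lt m.2)).elim (even_row m) (last_row m)
  have hright := eq_zero_of_sum_chainVec_eq_zero (fun k => w (Fin.natAdd M k))
    fun m hm => hg0 ⟨m, hm⟩
  funext i
  induction i using Fin.addCases with
  | left m => simpa [hg0 m] using odd_row m
  | right m => exact congrFun hright m

/-- For even `N ≥ 2`, `Γ` is similar to `Λ_N = diag(−I_{N/2}, J_{N/2})`. -/
theorem gamma_similar_lambda_even (N : ℕ) (hN : 2 ≤ N) (hNe : Even N) :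
    ∃ T : Matrix (Fin N) (Fin N) ℝ, IsUnit T.det ∧ T⁻¹ * Gam N * T = LambdaMat N := by
  obtain ⟨M, rfl⟩ := hNe
  refine ⟨gamBasis M, isUnit_det_gamBasis M, ?_⟩
  rw [Matrix.mul_assoc, gam_mul_gamBasis, Matrix.nonsing_inv_mul_cancel_left _ _
    (isUnit_det_gamBasis M)]
end

section
/- Let N ≥ 2 be even. Then the characteristic polynomial of Γ is (X + 1)^{N/2} (X − 1)^{N/2}, and consequently the set of distinct eigenvalues of Γ over ℂ is exactly {−1, 1}. -/
open Matrix Polynomial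

/-- The bijection listing the even indices `2i` first and then the odd indices `2i + 1`. -/
noncomputable def evenOddEquiv (n : ℕ) : Fin n ⊕ Fin n ≃ Fin (n + n) :=
  Equiv.ofBijective
    (Sum.elim (fun i => ⟨2 * i.1, by lia⟩) (fun i => ⟨2 * i.1 + 1, by lia⟩)) <| by
      rw [Fintype.bijective_iff_injective_and_card]
      refine ⟨?_, by simp⟩
      rintro (i | i) (j | j) h <;> simp [Fin.ext_iff] at h ⊢ <;> lia

/-- The diagonal block of `Γ` on the vectors constant on each pair `{2i, 2i + 1}`. -/
def pairSumBlock (n : ℕ) : Matrix (Fin n) (Fin n) ℝ :=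
  Matrix.of fun i j => if i = j then 1 else if j < i then 0 else 2

theorem charpoly_pairSumBlock (n : ℕ) : (pairSumBlock n).charpoly = (X - 1) ^ n := by
  rw [charpoly_of_isUpperTriangular]
  · simp [pairSumBlock]
  · intro i j hij
    have hlt : j < i := hij
    simp [pairSumBlock, hlt, hlt.ne']

/-- Conjugating by a block unipotent matrix makes a `2 × 2` block matrix block upper triangular
when both block rows have the same sum. -/
theorem charpoly_fromBlocks_of_add_eq_add {R m : Type*} [CommRing R] [Fintype m] [DecidableEq m]
    (A B C D : Matrix m m R) (h : C + D = A + B) :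
    (fromBlocks A B C D).charpoly = (A + B).charpoly * (D - B).charpoly := by
  let U : (Matrix (m ⊕ m) (m ⊕ m) R)ˣ :=
    ⟨fromBlocks 1 0 (-1) 1, fromBlocks 1 0 1 1,
      by simp [fromBlocks_multiply], by simp [fromBlocks_multiply]⟩
  have key : U.val * fromBlocks A B C D * U.inv = fromBlocks (A + B) B 0 (D - B) := by
    simp only [U, fromBlocks_multiply]
    congr 1
    · simp
    · simp
    · simp only [Matrix.mul_one, Matrix.one_mul, Matrix.neg_mul]
      rw [← sub_eq_zero] at h
      rw [← h]
      abel
    · simp [sub_eq_add_neg, add_comm]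
  rw [← charpoly_fromBlocks_zero₂₁ (A + B) B, ← key]
  rw [charpoly_mul_comm, ← mul_assoc, U.inv_val, one_mul]

theorem charpoly_Gam_add_self (n : ℕ) :
    (Gam (n + n)).charpoly = (X + 1) ^ n * (X - 1) ^ n := by
  let M := reindex (evenOddEquiv n).symm (evenOddEquiv n).symm (Gam (n + n))
  have hsum : M.toBlocks₁₁ + M.toBlocks₁₂ = pairSumBlock n := by
    ext i j
    simp [M, toBlocks₁₁, toBlocks₁₂, evenOddEquiv, Gam, pairSumBlock, Fin.ext_iff]
    grind
  have hsum' : M.toBlocks₂₁ + M.toBlocks₂₂ = pairSumBlock n := by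
    ext i j
    simp [M, toBlocks₂₁, toBlocks₂₂, evenOddEquiv, Gam, pairSumBlock, Fin.ext_iff]
    grind
  have hdiff : M.toBlocks₂₂ - M.toBlocks₁₂ = -1 := by
    ext i j
    simp [M, toBlocks₁₂, toBlocks₂₂, evenOddEquiv, Gam, Matrix.one_apply, Fin.ext_iff]
    grind
  have hneg : (-1 : Matrix (Fin n) (Fin n) ℝ).charpoly = (X + 1) ^ n := by
    rw [charpoly_of_isUpperTriangular]
    · simp
    · intro i j hij
      have hlt : j < i := hij
      simp [hlt.ne']
  rw [← charpoly_reindex (evenOddEquiv n).symm, ← fromBlocks_toBlocks (reindex _ _ _),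
    charpoly_fromBlocks_of_add_eq_add _ _ _ _ (hsum'.trans hsum.symm), hsum, hdiff, hneg,
    charpoly_pairSumBlock, mul_comm]

/-- For even `N ≥ 2`, the characteristic polynomial of `Γ` is `(X + 1)^{N/2} (X − 1)^{N/2}`,
and the set of distinct eigenvalues of `Γ` over `ℂ` is exactly `{−1, 1}`. -/
theorem gamma_charpoly_even (N : ℕ) (hN : 2 ≤ N) (hNe : Even N) :
    (Gam N).charpoly = (X + 1) ^ (N / 2) * (X - 1) ^ (N / 2) ∧
      spectrum ℂ ((Gam N).map Complex.ofReal) = {-1, 1} := by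
  obtain ⟨n, rfl⟩ := hNe
  have hn : n ≠ 0 := by lia
  rw [show (n + n) / 2 = n by lia]
  refine ⟨charpoly_Gam_add_self n, ?_⟩
  ext z
  rw [mem_spectrum_iff_isRoot_charpoly]
  have hmap := charpoly_map (Gam (n + n)) Complex.ofRealHom
  rw [charpoly_Gam_add_self] at hmap
  change ((Gam (n + n)).map Complex.ofRealHom).charpoly.IsRoot z ↔ _
  rw [hmap]
  simp [hn, sub_eq_zero, add_eq_zero_iff_eq_neg]
end

section
/- Let N ≥ 3 be odd. Then the characteristic polynomial of Γ is X·(X + 1)^{(N−1)/2}·(X − 1)^{(N−1)/2}, and consequently the set of distinct eigenvalues of Γ over ℂ is exactly {−1, 0, 1}. -/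
open Matrix Polynomial

namespace Gam

variable (m : ℕ)

/-- Splitting of `Fin (2 * m + 1)` into even and odd indices. -/
def evenOdd : Fin (m + 1) ⊕ Fin m → Fin (2 * m + 1)
  | .inl i => ⟨2 * i, by omega⟩
  | .inr k => ⟨2 * k + 1, by omega⟩

lemma evenOdd_bijective : Function.Bijective (evenOdd m) := by
  rw [Fintype.bijective_iff_injective_and_card]
  refine ⟨?_, by simp; ring⟩
  rintro (a | a) (b | b) h <;> simp only [evenOdd, Fin.mk.injEq] at h
  · exact congrArg _ (Fin.ext (by omega))
  · omega
  · omega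
  · exact congrArg _ (Fin.ext (by omega))

/-- The `m × (m + 1)` matrix `[1 | 0]`. -/
def truncation : Matrix (Fin m) (Fin (m + 1)) ℝ :=
  Matrix.of fun k j => if k.castSucc = j then 1 else 0

/-- The matrix of `Γ` on the invariant subspace of vectors `v` with `v (2 * k) = v (2 * k + 1)`
for all `k < m`. -/
def evenBlock : Matrix (Fin (m + 1)) (Fin (m + 1)) ℝ :=
  Matrix.of fun i j =>
    if i < j then (if j.1 < m then 2 else 1)
    else if i = j then (if j.1 < m then 1 else 0)
    else 0

variable {m}

lemma truncation_mul {n : Type*} (M : Matrix (Fin (m + 1)) n ℝ) :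
    truncation m * M = M.submatrix Fin.castSucc id := by
  ext k j
  simp [truncation, Matrix.mul_apply]

lemma mul_truncation_apply {n : Type*} (M : Matrix n (Fin m) ℝ) (i : n) (j : Fin (m + 1)) :
    (M * truncation m) i j = if h : j.1 < m then M i ⟨j, h⟩ else 0 := by
  simp only [truncation, Matrix.mul_apply, Matrix.of_apply, mul_ite, mul_one, mul_zero]
  split_ifs with h
  · rw [Finset.sum_eq_single ⟨j, h⟩]
    · simp
    · intro b _ hb
      exact if_neg fun h' => hb (Fin.ext (by simp [← h']))
    · simp
  · refine Finset.sum_eq_zero fun b _ => if_neg fun h' => h ?_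
    simp [← h']

variable (m)

lemma submatrix_evenOdd_mul :
    (Gam (2 * m + 1)).submatrix (evenOdd m) (evenOdd m) * fromBlocks 1 0 (truncation m) 1 =
      fromBlocks 1 0 (truncation m) 1 *
        fromBlocks (evenBlock m) (Matrix.of fun _ _ => 1) 0 (-1) := by
  rw [← fromBlocks_toBlocks ((Gam (2 * m + 1)).submatrix (evenOdd m) (evenOdd m)),
    fromBlocks_multiply, fromBlocks_multiply]
  congr 1 <;> ext i j <;>
    simp [truncation_mul, mul_truncation_apply, toBlocks₁₁, toBlocks₁₂, toBlocks₂₁, toBlocks₂₂,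
      Gam, evenOdd, evenBlock, Matrix.one_apply, Fin.ext_iff, Fin.lt_def,
      -Fin.val_fin_lt] <;>
    grind

lemma charpoly_evenBlock : (evenBlock m).charpoly = X * (X - 1) ^ m := by
  rw [charpoly_of_isUpperTriangular]
  · simp [Fin.prod_univ_castSucc, evenBlock, mul_comm]
  · intro i j h
    have h' : j < i := h
    simp [evenBlock, h'.not_gt, h'.ne']

lemma charpoly_odd :
    (Gam (2 * m + 1)).charpoly = X * (X + 1) ^ m * (X - 1) ^ m := by
  have hP : IsUnit (fromBlocks 1 0 (truncation m) 1 :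
      Matrix (Fin (m + 1) ⊕ Fin m) (Fin (m + 1) ⊕ Fin m) ℝ) := by
    simp [Matrix.isUnit_iff_isUnit_det]
  obtain ⟨P, hP⟩ := hP
  have h := submatrix_evenOdd_mul m
  rw [← hP, ← Units.eq_mul_inv_iff_mul_eq] at h
  have hneg : (-1 : Matrix (Fin m) (Fin m) ℝ).charpoly = (X + 1) ^ m := by
    rw [charpoly_of_isUpperTriangular _ (blockTriangular_one.neg)]
    simp
  rw [← charpoly_reindex (Equiv.ofBijective _ (evenOdd_bijective m)).symm, reindex_apply]
  change ((Gam (2 * m + 1)).submatrix (evenOdd m) (evenOdd m)).charpoly = _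
  rw [h, coe_units_inv, charpoly_units_conj, charpoly_fromBlocks_zero₂₁, charpoly_evenBlock, hneg]
  ring

end Gam

/-- For odd `N ≥ 3`, the characteristic polynomial of `Γ` is
`X (X + 1)^{(N−1)/2} (X − 1)^{(N−1)/2}`, and the set of distinct eigenvalues of `Γ` over `ℂ`
is exactly `{−1, 0, 1}`. -/
theorem gamma_charpoly_odd (N : ℕ) (hN : 3 ≤ N) (hNo : Odd N) :
    (Gam N).charpoly = X * (X + 1) ^ ((N - 1) / 2) * (X - 1) ^ ((N - 1) / 2) ∧
      spectrum ℂ ((Gam N).map Complex.ofReal) = {-1, 0, 1} := by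
  obtain ⟨m, rfl⟩ := hNo
  have hm : m ≠ 0 := by omega
  rw [show (2 * m + 1 - 1) / 2 = m by omega]
  refine ⟨Gam.charpoly_odd m, ?_⟩
  ext z
  have hmap : ((Gam (2 * m + 1)).map Complex.ofReal).charpoly =
      X * (X + 1) ^ m * (X - 1) ^ m := by
    have h := charpoly_map (Gam (2 * m + 1)) Complex.ofRealHom
    rw [Gam.charpoly_odd m] at h
    simp only [Polynomial.map_mul, Polynomial.map_pow, Polynomial.map_add, Polynomial.map_sub,
      Polynomial.map_X, Polynomial.map_one] at h
    exact h
  rw [mem_spectrum_iff_isRoot_charpoly, hmap]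
  simp [hm, sub_eq_zero, add_eq_zero_iff_eq_neg]
  tauto
end

section
/- Let N ≥ 3 be odd. Then the characteristic polynomial of Γ_D is X·(X + 1)·(X + N)·∏_{k=1}^{(N−3)/2} (X + (2k+1))²; equivalently, the eigenvalues of Γ_D with multiplicity are −N, −(N−2), −(N−2), …, −3, −3, −1, 0 (each odd number m with 3 ≤ m ≤ N−2 giving the double eigenvalue −m). In particular, for N = 3 the eigenvalues are −3, −1 and 0. -/
open Matrix Polynomial

/-- Off-diagonal entries of the diffusive coupling matrix `Γ_D` (1-indexed: `γ_{ij} = −1` if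
`i > j`, `j ≤ i−2` and `j` is odd; `γ_{ij} = 1` for all other `i ≠ j`). Indices 0-based here. -/
def GamDOff (N : ℕ) (i j : Fin N) : ℝ :=
  if j.1 + 2 ≤ i.1 ∧ j.1 % 2 = 0 then -1 else 1

/-- The diffusive coupling matrix `Γ_D`: off-diagonal entries as in `GamDOff`, and diagonal
entries `γ_{ii} = −∑_{j ≠ i} γ_{ij}`, so every row sums to zero. -/
def GamD (N : ℕ) : Matrix (Fin N) (Fin N) ℝ :=
  Matrix.of fun i j =>
    if i = j then -(∑ k ∈ Finset.univ \ {i}, GamDOff N i k) else GamDOff N i j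

theorem Matrix.charpoly_add_vecMulVec_of_mulVec_eq_smul {n R : Type*} [Fintype n] [DecidableEq n]
    [Nonempty n] [CommRing R] [IsDomain R] (B : Matrix n n R) (u v : n → R) (c : R)
    (h : B *ᵥ u = c • u) :
    (X - C c) * (B + vecMulVec u v).charpoly = (X - C c - C (u ⬝ᵥ v)) * B.charpoly := by
  set U : Matrix n n R[X] := (vecMulVec u v).map C with hU
  have hBU : B.map C * U = C c • U := by
    rw [hU, ← Matrix.map_mul, mul_vecMulVec, h]
    ext1 i j
    simp [vecMulVec_apply]
  have hmul : B.charmatrix * (scalar n (X - C c) - U)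
      = (X - C c) • (B + vecMulVec u v).charmatrix := by
    have e (p : R[X]) : scalar n p = p • (1 : Matrix n n R[X]) := by
      ext1 i j
      simp [Matrix.smul_apply, one_apply, diagonal_apply]
    rw [charmatrix, charmatrix, RingHom.mapMatrix_apply, RingHom.mapMatrix_apply,
      Matrix.map_add C (fun _ _ => map_add C _ _), ← hU, e, e, mul_sub, sub_mul (X • 1) _ U, hBU]
    simp only [mul_smul_comm, mul_one, smul_mul_assoc, one_mul]
    module
  have hn : Fintype.card n = Fintype.card n - 1 + 1 :=
    (Nat.sub_add_cancel Fintype.card_pos).symm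
  have hdet := congrArg det hmul
  have hscal : det (scalar n (X - C c) - U)
      = (X - C c) ^ (Fintype.card n - 1) * (X - C c - C (u ⬝ᵥ v)) := by
    have hU' : U = vecMulVec (fun i => C (u i)) (fun i => C (v i)) := by
      ext1 i j
      simp [hU, vecMulVec_apply]
    have hd : (fun i => C (u i)) ⬝ᵥ (fun i => C (v i)) = C (u ⬝ᵥ v) := by
      simp [dotProduct]
    rw [← eval_charpoly, hU', charpoly_vecMulVec, hd]
    simp only [eval_sub, eval_pow, eval_X, eval_smul, smul_eq_mul]
    conv_lhs => rw [hn, Nat.add_sub_cancel]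
    ring
  rw [det_mul, hscal, det_smul] at hdet
  rw [hn, Nat.add_sub_cancel] at hdet
  refine mul_left_cancel₀ (pow_ne_zero (Fintype.card n - 1) (X_sub_C_ne_zero c)) ?_
  rw [charpoly, charpoly]
  linear_combination -hdet

theorem sum_range_ite_even (i n : ℕ) :
    ∑ k ∈ Finset.range n, (if k + 2 ≤ i ∧ k % 2 = 0 then (-1 : ℝ) else 1)
      = n - 2 * (min (i / 2) ((n + 1) / 2) : ℕ) := by
  induction n with
  | zero => simp
  | succ n ih =>
    rw [Finset.sum_range_succ, ih]
    split_ifs with h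
    · rw [show min (i / 2) ((n + 1 + 1) / 2) = min (i / 2) ((n + 1) / 2) + 1 by omega]
      push_cast
      ring
    · rw [show min (i / 2) ((n + 1 + 1) / 2) = min (i / 2) ((n + 1) / 2) by omega]
      push_cast
      ring

theorem sum_GamDOff (N : ℕ) (i : Fin N) :
    ∑ k ∈ Finset.univ \ {i}, GamDOff N i k = N - 1 - 2 * (i.1 / 2 : ℕ) := by
  have hall : ∑ k, GamDOff N i k = N - 2 * (i.1 / 2 : ℕ) := by
    have := sum_range_ite_even i.1 N
    rw [min_eq_left (by omega), ← Fin.sum_univ_eq_sum_range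
      (fun k => if k + 2 ≤ i.1 ∧ k % 2 = 0 then (-1 : ℝ) else 1)] at this
    exact this
  have hself : GamDOff N i i = 1 := by simp [GamDOff]
  have := Finset.sum_sdiff (Finset.subset_univ {i}) (f := GamDOff N i)
  rw [Finset.sum_singleton] at this
  linarith

theorem GamD_mulVec_one (N : ℕ) : GamD N *ᵥ 1 = 0 := by
  ext i
  have hoff : ∑ j ∈ Finset.univ \ {i}, GamD N i j = ∑ j ∈ Finset.univ \ {i}, GamDOff N i j :=
    Finset.sum_congr rfl fun j hj => by
      have hij : i ≠ j := fun h => by simp [h] at hj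
      simp [GamD, hij]
  simp only [mulVec, dotProduct, Pi.one_apply, mul_one, Pi.zero_apply]
  rw [← Finset.sum_sdiff (Finset.subset_univ {i}), hoff, Finset.sum_singleton]
  simp [GamD]

theorem charpoly_GamD_sub_vecMulVec_one (N : ℕ) :
    (GamD N - vecMulVec 1 1).charpoly
      = ∏ i ∈ Finset.range N, (X + C ((N : ℝ) - 2 * (i / 2 : ℕ))) := by
  have hlow : (GamD N - vecMulVec 1 1).charmatrix.IsLowerTriangular := by
    intro i j hij
    have hlt : i < j := hij
    have hnot : ¬ (j.1 + 2 ≤ i.1 ∧ j.1 % 2 = 0) := by omega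
    rw [charmatrix_apply_ne _ _ _ hlt.ne]
    simp [GamD, GamDOff, hlt.ne, hnot]
  rw [charpoly, det_of_isLowerTriangular _ hlow,
    ← Fin.prod_univ_eq_prod_range fun i => X + C ((N : ℝ) - 2 * (i / 2 : ℕ))]
  refine Finset.prod_congr rfl fun i _ => ?_
  rw [charmatrix_apply_eq, sub_eq_add_neg, ← C_neg]
  congr 2
  simp only [GamD, Matrix.sub_apply, of_apply, if_true, sum_GamDOff, vecMulVec_apply,
    Pi.one_apply]
  ring

theorem Finset.prod_range_two_mul_div_two {M : Type*} [CommMonoid M] (f : ℕ → M) (m : ℕ) :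
    ∏ i ∈ Finset.range (2 * m), f (i / 2) = ∏ k ∈ Finset.range m, f k ^ 2 := by
  induction m with
  | zero => simp
  | succ m ih =>
    rw [Nat.mul_succ, Finset.prod_range_succ, Finset.prod_range_succ, ih, Finset.prod_range_succ,
      show 2 * m / 2 = m by omega, show (2 * m + 1) / 2 = m by omega, mul_assoc, sq]

/-- For odd `N ≥ 3`, the characteristic polynomial of `Γ_D` is
`X (X + 1) (X + N) ∏_{k=1}^{(N−3)/2} (X + (2k+1))²`; i.e. the eigenvalues with multiplicity
are `−N, −(N−2), −(N−2), …, −3, −3, −1, 0`. -/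
theorem gammaD_charpoly_odd (N : ℕ) (hN : 3 ≤ N) (hNo : Odd N) :
    (GamD N).charpoly =
      X * (X + 1) * (X + C (N : ℝ)) *
        ∏ k ∈ Finset.Icc 1 ((N - 3) / 2), (X + C (2 * (k : ℝ) + 1)) ^ 2 := by
  obtain ⟨m, rfl⟩ : ∃ m, N = 2 * (m + 1) + 1 := by
    obtain ⟨k, rfl⟩ := hNo
    exact ⟨k - 1, by omega⟩
  set N := 2 * (m + 1) + 1 with hNdef
  have hB : (GamD N - vecMulVec 1 1) *ᵥ 1 = (-(N : ℝ)) • (1 : Fin N → ℝ) := by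
    rw [sub_mulVec, GamD_mulVec_one]
    ext i
    simp [mulVec, dotProduct]
  have key := charpoly_add_vecMulVec_of_mulVec_eq_smul _ 1 1 _ hB
  have hprod : ∏ i ∈ Finset.range N, (X + C ((N : ℝ) - 2 * (i / 2 : ℕ)))
      = (X + 1) * (X + C (N : ℝ)) ^ 2 *
        ∏ k ∈ Finset.Icc 1 m, (X + C (2 * (k : ℝ) + 1)) ^ 2 := by
    have hIcc : ∏ k ∈ Finset.Icc 1 m, (X + C (2 * (k : ℝ) + 1)) ^ 2
        = ∏ k ∈ Finset.range m, (X + C ((N : ℝ) - 2 * (k + 1 : ℕ))) ^ 2 := by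
      rw [← Finset.Ico_add_one_right_eq_Icc, Finset.prod_Ico_eq_prod_range, Nat.add_sub_cancel,
        ← Finset.prod_range_reflect]
      refine Finset.prod_congr rfl fun k hk => ?_
      have hkm : k + (m - 1 - k) + 1 = m := by have := Finset.mem_range.1 hk; omega
      have hkm' : (k : ℝ) + (m - 1 - k : ℕ) + 1 = m := by exact_mod_cast hkm
      congr 3
      rw [hNdef]
      push_cast
      linarith
    rw [hNdef, Finset.prod_range_succ, ← hNdef,
      Finset.prod_range_two_mul_div_two (fun k => X + C ((N : ℝ) - 2 * (k : ℕ))),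
      Finset.prod_range_succ', hIcc, show 2 * (m + 1) / 2 = m + 1 by omega,
      show (N : ℝ) - 2 * (m + 1 : ℕ) = 1 by rw [hNdef]; push_cast; ring]
    simp only [Nat.cast_zero, mul_zero, sub_zero, C_1]
    ring
  rw [sub_add_cancel, charpoly_GamD_sub_vecMulVec_one, hprod] at key
  have hdot : (1 : Fin N → ℝ) ⬝ᵥ 1 = N := by simp
  rw [hdot, C_neg, sub_neg_eq_add, add_sub_cancel_right] at key
  rw [show (N - 3) / 2 = m by omega]
  refine mul_left_cancel₀ (X_add_C_ne_zero (N : ℝ)) ?_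
  rw [key]
  ring
end

section
/- Let N ≥ 2 be even. Then the characteristic polynomial of Γ_D is X·(X + N)·∏_{k=1}^{(N−2)/2} (X + 2k)²; equivalently, the eigenvalues of Γ_D with multiplicity are −N, −(N−2), −(N−2), …, −2, −2, 0 (each even number m with 2 ≤ m ≤ N−2 giving the double eigenvalue −m). In particular, for N = 2 the eigenvalues are −2 and 0. -/
open Matrix Polynomial

namespace GamD

/-- The splitting of `Fin (2 * n)` into its even elements (left) and its odd elements (right). -/
noncomputable def parityEquiv (n : ℕ) : Fin n ⊕ Fin n ≃ Fin (2 * n) :=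
  Equiv.ofBijective
    (Sum.elim (fun m => ⟨2 * m.1, by omega⟩) (fun m => ⟨2 * m.1 + 1, by omega⟩)) <| by
      rw [Fintype.bijective_iff_injective_and_card]
      refine ⟨?_, by simp; omega⟩
      rintro (a | a) (b | b) h <;> simp [Fin.ext_iff] at h ⊢ <;> omega

@[simp]
lemma parityEquiv_inl_val {n : ℕ} (m : Fin n) : (parityEquiv n (Sum.inl m)).1 = 2 * m.1 := rfl

@[simp]
lemma parityEquiv_inr_val {n : ℕ} (m : Fin n) :
    (parityEquiv n (Sum.inr m)).1 = 2 * m.1 + 1 := rfl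

lemma sum_off (n : ℕ) (i : Fin (2 * n)) :
    ∑ k, GamDOff (2 * n) i k = 2 * n - 2 * (i.1 / 2 : ℕ) := by
  rw [← (parityEquiv n).sum_comp, Fintype.sum_sum_type, ← Finset.sum_add_distrib]
  have hterm (m : Fin n) :
      GamDOff (2 * n) i (parityEquiv n (Sum.inl m)) +
        GamDOff (2 * n) i (parityEquiv n (Sum.inr m)) =
          2 - 2 * (if m.1 < i.1 / 2 then 1 else 0) := by
    have h : 2 * m.1 + 2 ≤ i.1 ↔ m.1 < i.1 / 2 := by omega
    have h' : ¬ (2 * m.1 + 1) % 2 = 0 := by omega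
    simp only [GamDOff, parityEquiv_inl_val, parityEquiv_inr_val, h, h', and_false, if_false,
      Nat.mul_mod_right, and_true]
    split_ifs <;> norm_num
  have hcard : (Finset.univ.filter fun m : Fin n => m.1 < i.1 / 2).card = i.1 / 2 := by
    rw [Fin.card_filter_val_lt]
    omega
  simp only [hterm, Finset.sum_sub_distrib, ← Finset.mul_sum, Finset.sum_boole, hcard]
  simp [mul_comm]

lemma diag_apply (n : ℕ) (i : Fin (2 * n)) :
    GamD (2 * n) i i = 2 * (i.1 / 2 : ℕ) - 2 * n + 1 := by
  have h := Finset.sum_sdiff (f := GamDOff (2 * n) i) (Finset.subset_univ {i})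
  have hii : GamDOff (2 * n) i i = 1 := by simp [GamDOff]
  rw [Finset.sum_singleton, hii, sum_off] at h
  simp only [GamD, Matrix.of_apply, if_true]
  linarith

lemma off_diag_apply {N : ℕ} {i j : Fin N} (h : i ≠ j) :
    GamD N i j = if j.1 + 2 ≤ i.1 ∧ j.1 % 2 = 0 then -1 else 1 := by
  simp [GamD, GamDOff, h]

/-- The action of `Γ_D` on the vectors `e_{2m} + e_{2m+1}`. -/
def symmBlock (n : ℕ) : Matrix (Fin n) (Fin n) ℝ :=
  Matrix.of fun i j => if j < i then 0 else if i = j then 2 * (i.1 : ℝ) - 2 * n + 2 else 2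

/-- The component of `Γ_D (e_{2m} - e_{2m+1})` along the vectors `e_{2l} + e_{2l+1}`. -/
def mixedBlock (n : ℕ) : Matrix (Fin n) (Fin n) ℝ :=
  Matrix.of fun i j => if j < i then -2 else 0

/-- The eigenvalues of `Γ_D` on the vectors `e_{2m} - e_{2m+1}`, modulo the span of the
`e_{2l} + e_{2l+1}`. -/
def antisymmBlock (n : ℕ) : Matrix (Fin n) (Fin n) ℝ :=
  Matrix.diagonal fun i => 2 * (i.1 : ℝ) - 2 * n

/-- The change of basis to the vectors `e_{2m} + e_{2m+1}` and `e_{2m} - e_{2m+1}`. -/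
def pairBasis (n : ℕ) : Matrix (Fin n ⊕ Fin n) (Fin n ⊕ Fin n) ℝ :=
  Matrix.fromBlocks 1 1 1 (-1)

lemma pairBasis_mul_half_smul (n : ℕ) : pairBasis n * ((1 / 2 : ℝ) • pairBasis n) = 1 := by
  rw [Matrix.mul_smul, pairBasis, Matrix.fromBlocks_multiply, Matrix.fromBlocks_smul,
    ← Matrix.fromBlocks_one]
  congr 1 <;> simp [← two_smul ℝ (1 : Matrix (Fin n) (Fin n) ℝ), smul_smul]

lemma submatrix_mul_pairBasis (n : ℕ) :
    (GamD (2 * n)).submatrix (parityEquiv n) (parityEquiv n) * pairBasis n =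
      pairBasis n *
        Matrix.fromBlocks (symmBlock n) (mixedBlock n) 0 (antisymmBlock n) := by
  rw [← Matrix.fromBlocks_toBlocks ((GamD (2 * n)).submatrix _ _), pairBasis,
    Matrix.fromBlocks_multiply, Matrix.fromBlocks_multiply]
  have hne {i j : Fin n ⊕ Fin n} (h : i ≠ j) : parityEquiv n i ≠ parityEquiv n j :=
    (parityEquiv n).injective.ne h
  have h11 (i j : Fin n) : GamD (2 * n) (parityEquiv n (Sum.inl i)) (parityEquiv n (Sum.inl j)) =
      if j < i then -1 else if i = j then 2 * (i.1 : ℝ) - 2 * n + 1 else 1 := by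
    by_cases h : i = j
    · subst h
      simp [diag_apply]
    · rw [off_diag_apply (hne (by simpa using h))]
      have : 2 * j.1 + 2 ≤ 2 * i.1 ↔ j < i := by rw [Fin.lt_def]; omega
      simp [h, this]
  have h12 (i j : Fin n) :
      GamD (2 * n) (parityEquiv n (Sum.inl i)) (parityEquiv n (Sum.inr j)) = 1 := by
    rw [off_diag_apply (hne (by simp)), if_neg]
    simp only [parityEquiv_inl_val, parityEquiv_inr_val]
    omega
  have h21 (i j : Fin n) : GamD (2 * n) (parityEquiv n (Sum.inr i)) (parityEquiv n (Sum.inl j)) =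
      if j < i then -1 else 1 := by
    rw [off_diag_apply (hne (by simp))]
    have : 2 * j.1 + 2 ≤ 2 * i.1 + 1 ↔ j < i := by rw [Fin.lt_def]; omega
    simp only [parityEquiv_inl_val, parityEquiv_inr_val, this, Nat.mul_mod_right, and_true]
  have h22 (i j : Fin n) : GamD (2 * n) (parityEquiv n (Sum.inr i)) (parityEquiv n (Sum.inr j)) =
      if i = j then 2 * (i.1 : ℝ) - 2 * n + 1 else 1 := by
    by_cases h : i = j
    · subst h
      have : (2 * i.1 + 1) / 2 = i.1 := by omega
      simp [diag_apply, this]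
    · rw [off_diag_apply (hne (by simpa using h)), if_neg, if_neg h]
      simp only [parityEquiv_inr_val]
      omega
  congr 1 <;> ext i j <;>
    simp only [toBlocks₁₁, toBlocks₁₂, toBlocks₂₁, toBlocks₂₂, Matrix.submatrix_apply, h11, h12,
      h21, h22, symmBlock, mixedBlock, antisymmBlock, Matrix.diagonal_apply, Matrix.add_apply,
      Matrix.neg_apply, Matrix.zero_apply, Matrix.of_apply, mul_one, one_mul, mul_neg, neg_mul,
      mul_zero, add_zero] <;>
    grind

lemma charpoly_eq_mul (n : ℕ) :
    (GamD (2 * n)).charpoly = (symmBlock n).charpoly * (antisymmBlock n).charpoly := by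
  have h := pairBasis_mul_half_smul n
  rw [← Matrix.charpoly_reindex (parityEquiv n).symm, Matrix.reindex_apply, Equiv.symm_symm,
    ← Matrix.charpoly_fromBlocks_zero₂₁ _ (mixedBlock n),
    ← mul_one ((GamD (2 * n)).submatrix _ _), ← h, ← mul_assoc, submatrix_mul_pairBasis,
    mul_assoc, Matrix.charpoly_mul_comm, mul_assoc, mul_eq_one_comm.mp h, mul_one]

lemma charpoly_symmBlock (n : ℕ) :
    (symmBlock n).charpoly = ∏ j ∈ Finset.range n, (X + C (2 * (j : ℝ))) := by
  rw [Matrix.charpoly_of_isUpperTriangular _ fun i j (h : j < i) => by simp [symmBlock, h],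
    ← Finset.prod_range_reflect, Finset.prod_range]
  refine Finset.prod_congr rfl fun i _ => ?_
  rw [Nat.sub_sub, Nat.cast_sub (by omega), sub_eq_add_neg, ← C_neg]
  congr 2
  simp [symmBlock]
  ring

lemma charpoly_antisymmBlock (n : ℕ) :
    (antisymmBlock n).charpoly = ∏ j ∈ Finset.range n, (X + C (2 * ((j + 1 : ℕ) : ℝ))) := by
  rw [antisymmBlock, Matrix.charpoly_diagonal, ← Finset.prod_range_reflect, Finset.prod_range]
  refine Finset.prod_congr rfl fun i _ => ?_
  rw [show n - 1 - i.1 + 1 = n - i.1 by omega, Nat.cast_sub i.2.le, sub_eq_add_neg, ← C_neg]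
  congr 2
  ring

end GamD

/-- For even `N ≥ 2`, the characteristic polynomial of `Γ_D` is
`X (X + N) ∏_{k=1}^{(N−2)/2} (X + 2k)²`; i.e. the eigenvalues with multiplicity are
`−N, −(N−2), −(N−2), …, −2, −2, 0`. -/
theorem gammaD_charpoly_even (N : ℕ) (hN : 2 ≤ N) (hNe : Even N) :
    (GamD N).charpoly =
      X * (X + C (N : ℝ)) *
        ∏ k ∈ Finset.Icc 1 ((N - 2) / 2), (X + C (2 * (k : ℝ))) ^ 2 := by
  obtain ⟨p, rfl⟩ : ∃ p, N = 2 * (p + 1) := by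
    obtain ⟨r, rfl⟩ := hNe
    exact ⟨r - 1, by omega⟩
  have hIcc : Finset.Icc 1 ((2 * (p + 1) - 2) / 2) = Finset.Ico 1 (p + 1) := by
    ext k
    simp only [Finset.mem_Icc, Finset.mem_Ico]
    omega
  rw [GamD.charpoly_eq_mul, GamD.charpoly_symmBlock, GamD.charpoly_antisymmBlock,
    Finset.prod_range_succ', Finset.prod_range_succ, hIcc, Finset.prod_Ico_eq_prod_range,
    Finset.prod_pow]
  simp only [add_tsub_cancel_right, add_comm 1, Nat.cast_mul, Nat.cast_ofNat, Nat.cast_zero,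
    mul_zero, C_0, add_zero]
  ring
end

section
/- Let A1 be a real n×n matrix, B1 a real n×m matrix, C1 a real l×n matrix, and set A12 = B1·C1. Let Γ be any real N×N matrix all of whose row sums are zero (Γ·E_N = 0), and let A = I_N ⊗ A1 + Γ ⊗ A12. Then for every s ∈ ℂ such that both s·I_{Nn} − A and s·I_n − A1 are invertible (as complex matrices), the network transfer function satisfies (E_Nᵀ ⊗ C1)·(s·I_{Nn} − A)⁻¹·(E_N ⊗ B1) = N · C1·(s·I_n − A1)⁻¹·B1. -/
open Matrix Kronecker

/-- If `G * E = 0`, then on matrices `E ⊗ B` the resolvent of `1 ⊗ A + G ⊗ K` acts as the resolvent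
of `A` on the second factor. -/
theorem resolvent_kronecker_mul_of_mul_eq_zero {R ι κ μ ν : Type*} [CommRing R]
    [Fintype ι] [DecidableEq ι] [Fintype κ] [DecidableEq κ] (s : R)
    (A K : Matrix κ κ R) (G : Matrix ι ι R) (E : Matrix ι μ R) (B : Matrix κ ν R)
    (hGE : G * E = 0)
    (hnet : IsUnit (s • (1 : Matrix (ι × κ) (ι × κ) R) - (1 ⊗ₖ A + G ⊗ₖ K)))
    (hnode : IsUnit (s • (1 : Matrix κ κ R) - A)) :
    (s • (1 : Matrix (ι × κ) (ι × κ) R) - (1 ⊗ₖ A + G ⊗ₖ K))⁻¹ * (E ⊗ₖ B) =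
      E ⊗ₖ ((s • (1 : Matrix κ κ R) - A)⁻¹ * B) := by
  rw [isUnit_iff_isUnit_det] at hnet hnode
  have hsplit : s • (1 : Matrix (ι × κ) (ι × κ) R) - (1 ⊗ₖ A + G ⊗ₖ K) =
      1 ⊗ₖ (s • (1 : Matrix κ κ R) - A) - G ⊗ₖ K := by
    rw [sub_eq_add_neg (s • (1 : Matrix κ κ R)), kronecker_add, kronecker_smul,
      one_kronecker_one, ← neg_one_smul R A, kronecker_smul, neg_one_smul]
    abel
  have hmul : (s • (1 : Matrix (ι × κ) (ι × κ) R) - (1 ⊗ₖ A + G ⊗ₖ K)) *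
      (E ⊗ₖ ((s • (1 : Matrix κ κ R) - A)⁻¹ * B)) = E ⊗ₖ B := by
    rw [hsplit, Matrix.sub_mul, ← mul_kronecker_mul, ← mul_kronecker_mul, hGE, Matrix.one_mul,
      mul_nonsing_inv_cancel_left _ _ hnode, zero_kronecker, sub_zero]
  rw [← hmul, nonsing_inv_mul_cancel_left _ _ hnet]

/-- For a coupling matrix `Γ` with all row sums zero (`Γ · E_N = 0`), the transfer function of
the network `A = I_N ⊗ A1 + Γ ⊗ A12`, `A12 = B1·C1`, with column-input `E_N ⊗ B1` and
row-output `E_Nᵀ ⊗ C1` equals `N` times the transfer function of a single node.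
(Note: `A12 = B1·C1` forces the input dimension `m` and output dimension `l` to coincide;
here both are `m`.) -/
theorem diffusive_transfer_function_row (n m N : ℕ)
    (A1 : Matrix (Fin n) (Fin n) ℝ) (B1 : Matrix (Fin n) (Fin m) ℝ)
    (C1 : Matrix (Fin m) (Fin n) ℝ) (Γ : Matrix (Fin N) (Fin N) ℝ)
    (EN : Matrix (Fin N) (Fin 1) ℝ) (hEN : EN = Matrix.of fun _ _ => 1)
    (hrow : Γ * EN = 0)
    (A : Matrix (Fin N × Fin n) (Fin N × Fin n) ℝ)
    (hA : A = (1 : Matrix (Fin N) (Fin N) ℝ) ⊗ₖ A1 + Γ ⊗ₖ (B1 * C1)) :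
    ∀ s : ℂ,
      IsUnit (s • (1 : Matrix (Fin N × Fin n) (Fin N × Fin n) ℂ) - A.map Complex.ofReal) →
      IsUnit (s • (1 : Matrix (Fin n) (Fin n) ℂ) - A1.map Complex.ofReal) →
      (EN.transpose ⊗ₖ C1).map Complex.ofReal *
          (s • (1 : Matrix (Fin N × Fin n) (Fin N × Fin n) ℂ) - A.map Complex.ofReal)⁻¹ *
          (EN ⊗ₖ B1).map Complex.ofReal =
        (N : ℂ) • ((1 : Matrix (Fin 1) (Fin 1) ℂ) ⊗ₖ
          (C1.map Complex.ofReal *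
            (s • (1 : Matrix (Fin n) (Fin n) ℂ) - A1.map Complex.ofReal)⁻¹ *
            B1.map Complex.ofReal)) := by
  intro s hnet hnode
  have map_kronecker {a b c d : Type} (X : Matrix a b ℝ) (Y : Matrix c d ℝ) :
      (X ⊗ₖ Y).map Complex.ofReal = X.map Complex.ofReal ⊗ₖ Y.map Complex.ofReal := by
    ext i j
    simp [kroneckerMap_apply]
  have hA_map : A.map Complex.ofReal =
      1 ⊗ₖ A1.map Complex.ofReal + Γ.map Complex.ofReal ⊗ₖ (B1 * C1).map Complex.ofReal := by
    rw [hA, Matrix.map_add _ Complex.ofReal_add, map_kronecker, map_kronecker,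
      Matrix.map_one _ Complex.ofReal_zero Complex.ofReal_one]
  have hrow_map : Γ.map Complex.ofReal * EN.map Complex.ofReal = 0 := by
    have h := Matrix.map_mul (L := Γ) (M := EN) (f := Complex.ofRealHom)
    rw [hrow, Matrix.map_zero _ (map_zero _)] at h
    exact h.symm
  have hsum : ENᵀ.map Complex.ofReal * EN.map Complex.ofReal =
      (N : ℂ) • (1 : Matrix (Fin 1) (Fin 1) ℂ) := by
    ext i j
    simp [hEN, Matrix.mul_apply, Subsingleton.elim i j]
  rw [hA_map] at hnet ⊢
  rw [map_kronecker, map_kronecker, Matrix.mul_assoc,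
    resolvent_kronecker_mul_of_mul_eq_zero s _ _ _ _ _ hrow_map hnet hnode,
    ← mul_kronecker_mul, hsum, smul_kronecker, Matrix.mul_assoc]
end

section
/- Let A1 be a real n×n matrix, B1 a real n×m matrix, C1 a real l×n matrix, and set A12 = B1·C1. Let Γ be any real N×N matrix all of whose column sums are zero (E_Nᵀ·Γ = 0), and let A = I_N ⊗ A1 + Γ ⊗ A12. Then for every s ∈ ℂ such that both s·I_{Nn} − A and s·I_n − A1 are invertible (as complex matrices), the network transfer function satisfies (E_Nᵀ ⊗ C1)·(s·I_{Nn} − A)⁻¹·(E_N ⊗ B1) = N · C1·(s·I_n − A1)⁻¹·B1. -/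
open Matrix Kronecker

/-- If the rows of `e` lie in the left kernel of `Γ`, then multiplying `e ⊗ C` by the resolvent of
`1 ⊗ A + Γ ⊗ K` only involves the resolvent of `A`. -/
theorem kronecker_mul_resolvent_of_mul_eq_zero {R ι κ n p : Type*} [CommRing R]
    [Fintype ι] [DecidableEq ι] [Fintype n] [DecidableEq n]
    {e : Matrix κ ι R} {Γ : Matrix ι ι R} (he : e * Γ = 0) (A K : Matrix n n R)
    (C : Matrix p n R) (s : R)
    (hM : IsUnit (s • (1 : Matrix (ι × n) (ι × n) R) - ((1 : Matrix ι ι R) ⊗ₖ A + Γ ⊗ₖ K)))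
    (hA : IsUnit (s • (1 : Matrix n n R) - A)) :
    (e ⊗ₖ C) * (s • (1 : Matrix (ι × n) (ι × n) R) - ((1 : Matrix ι ι R) ⊗ₖ A + Γ ⊗ₖ K))⁻¹ =
      e ⊗ₖ (C * (s • (1 : Matrix n n R) - A)⁻¹) := by
  have hsplit : s • (1 : Matrix (ι × n) (ι × n) R) - ((1 : Matrix ι ι R) ⊗ₖ A + Γ ⊗ₖ K) =
      (1 : Matrix ι ι R) ⊗ₖ (s • (1 : Matrix n n R) - A) - Γ ⊗ₖ K := by
    have hsum : (1 : Matrix ι ι R) ⊗ₖ (s • (1 : Matrix n n R) - A) + (1 : Matrix ι ι R) ⊗ₖ A =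
        s • (1 : Matrix (ι × n) (ι × n) R) := by
      rw [← kronecker_add, sub_add_cancel, kronecker_smul, one_kronecker_one]
    rw [← hsum]
    abel
  have hmul : e ⊗ₖ (C * (s • (1 : Matrix n n R) - A)⁻¹) *
      (s • (1 : Matrix (ι × n) (ι × n) R) - ((1 : Matrix ι ι R) ⊗ₖ A + Γ ⊗ₖ K)) = e ⊗ₖ C := by
    rw [hsplit, Matrix.mul_sub, ← mul_kronecker_mul, ← mul_kronecker_mul, he, zero_kronecker,
      sub_zero, Matrix.mul_one, Matrix.mul_assoc,
      nonsing_inv_mul _ ((isUnit_iff_isUnit_det _).1 hA), Matrix.mul_one]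
  rw [← hmul, mul_nonsing_inv_cancel_right _ _ ((isUnit_iff_isUnit_det _).1 hM)]

/-- For a coupling matrix `Γ` with all column sums zero (`E_Nᵀ · Γ = 0`), the transfer function of
the network `A = I_N ⊗ A1 + Γ ⊗ A12`, `A12 = B1·C1`, with column-input `E_N ⊗ B1` and
row-output `E_Nᵀ ⊗ C1` equals `N` times the transfer function of a single node.
(Note: `A12 = B1·C1` forces the input dimension `m` and output dimension `l` to coincide;
here both are `m`.) -/
theorem diffusive_transfer_function_col (n m N : ℕ)
    (A1 : Matrix (Fin n) (Fin n) ℝ) (B1 : Matrix (Fin n) (Fin m) ℝ)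
    (C1 : Matrix (Fin m) (Fin n) ℝ) (Γ : Matrix (Fin N) (Fin N) ℝ)
    (EN : Matrix (Fin N) (Fin 1) ℝ) (hEN : EN = Matrix.of fun _ _ => 1)
    (hcol : EN.transpose * Γ = 0)
    (A : Matrix (Fin N × Fin n) (Fin N × Fin n) ℝ)
    (hA : A = (1 : Matrix (Fin N) (Fin N) ℝ) ⊗ₖ A1 + Γ ⊗ₖ (B1 * C1)) :
    ∀ s : ℂ,
      IsUnit (s • (1 : Matrix (Fin N × Fin n) (Fin N × Fin n) ℂ) - A.map Complex.ofReal) →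
      IsUnit (s • (1 : Matrix (Fin n) (Fin n) ℂ) - A1.map Complex.ofReal) →
      (EN.transpose ⊗ₖ C1).map Complex.ofReal *
          (s • (1 : Matrix (Fin N × Fin n) (Fin N × Fin n) ℂ) - A.map Complex.ofReal)⁻¹ *
          (EN ⊗ₖ B1).map Complex.ofReal =
        (N : ℂ) • ((1 : Matrix (Fin 1) (Fin 1) ℂ) ⊗ₖ
          (C1.map Complex.ofReal *
            (s • (1 : Matrix (Fin n) (Fin n) ℂ) - A1.map Complex.ofReal)⁻¹ *
            B1.map Complex.ofReal)) := by
  intro s hM hA1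
  have hmap : A.map Complex.ofReal = (1 : Matrix (Fin N) (Fin N) ℂ) ⊗ₖ A1.map Complex.ofReal +
      Γ.map Complex.ofReal ⊗ₖ (B1 * C1).map Complex.ofReal := by
    subst hA
    ext ⟨i, a⟩ ⟨j, b⟩
    simp [kroneckerMap_apply, Matrix.one_apply, apply_ite Complex.ofReal]
  have hcolC : EN.transpose.map Complex.ofReal * Γ.map Complex.ofReal = 0 := by
    have h := congrArg (fun M => M.map Complex.ofRealHom) hcol
    rw [Matrix.map_mul, Matrix.map_zero _ (map_zero _)] at h
    exact h
  have hout : (EN.transpose ⊗ₖ C1).map Complex.ofReal =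
      EN.transpose.map Complex.ofReal ⊗ₖ C1.map Complex.ofReal := by
    ext; simp [kroneckerMap_apply]
  have hin : (EN ⊗ₖ B1).map Complex.ofReal =
      EN.map Complex.ofReal ⊗ₖ B1.map Complex.ofReal := by
    ext; simp [kroneckerMap_apply]
  have hsum : EN.transpose.map Complex.ofReal * EN.map Complex.ofReal =
      (N : ℂ) • (1 : Matrix (Fin 1) (Fin 1) ℂ) := by
    subst hEN
    ext i j
    simp [Matrix.mul_apply, Subsingleton.elim i j]
  rw [hmap] at hM ⊢
  rw [hout, hin, kronecker_mul_resolvent_of_mul_eq_zero hcolC _ _ _ s hM hA1,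
    ← mul_kronecker_mul, hsum, smul_kronecker]
end

section
/- Let N ≥ 4 be even and set M = N/2. Let A1 be a real n×n matrix, B1 a real n×m matrix, C1 a real l×n matrix, and A12 = B1·C1. Define real scalars c_1 = 2, c_2 = 0, and c_k = (−1)^{k−1}·2^{k−2} for 3 ≤ k ≤ M; and define scalars b^{(k)}_i recursively by b^{(2)} = (2, 1) and, for 3 ≤ k ≤ M: b^{(k)}_1 = 2, b^{(k)}_k = 1, and b^{(k)}_i = b^{(k−1)}_{i−1} + b^{(k−1)}_i for 2 ≤ i ≤ k−1. Let à = I_M ⊗ A1 + J_M ⊗ A12, let B̃ be the (Mn)×m block column matrix with i-th block b^{(M)}_i·B1, and let C̃ be the l×(Mn) block row matrix with k-th block c_k·C1. Then for every s ∈ ℂ such that both s·I_{Nn} − (I_N ⊗ A1 + Γ ⊗ A12) and s·I_{Mn} − Ã are invertible (as complex matrices), the transfer functions coincide: (E_Nᵀ ⊗ C1)·(s·I_{Nn} − I_N ⊗ A1 − Γ ⊗ A12)⁻¹·(E_N ⊗ B1) = C̃·(s·I_{Mn} − Ã)⁻¹·B̃. In particular, the full N-node network and the reduced M-block system have the same H₂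 norm whenever they are stable. -/
open Matrix Kronecker

/-- `J_m`: the `m × m` upper bidiagonal matrix with diagonal entries `1` and superdiagonal
entries `2`. -/
def Jmat (m : ℕ) : Matrix (Fin m) (Fin m) ℝ :=
  Matrix.of fun i j => if i = j then 1 else if j.1 = i.1 + 1 then 2 else 0

/-- If `Y` intertwines the state matrices `A` and `A'` and is compatible with the inputs and
outputs, the two systems have the same transfer function. -/
theorem transfer_eq_of_intertwining {ι κ μ ν R : Type*} [Fintype ι] [DecidableEq ι] [Fintype κ]
    [DecidableEq κ] [CommRing R] {A : Matrix ι ι R} {A' : Matrix κ κ R} {B : Matrix ι μ R}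
    {B' : Matrix κ μ R} {C : Matrix ν ι R} {C' : Matrix ν κ R} {Y : Matrix ι κ R}
    (hA : A * Y = Y * A') (hB : Y * B' = B) (hC : C * Y = C') (s : R)
    (h : IsUnit (s • (1 : Matrix ι ι R) - A)) (h' : IsUnit (s • (1 : Matrix κ κ R) - A')) :
    C * (s • (1 : Matrix ι ι R) - A)⁻¹ * B = C' * (s • (1 : Matrix κ κ R) - A')⁻¹ * B' := by
  have hs : (s • (1 : Matrix ι ι R) - A) * Y = Y * (s • (1 : Matrix κ κ R) - A') := by
    simp [Matrix.sub_mul, Matrix.mul_sub, hA]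
  rw [Matrix.isUnit_iff_isUnit_det] at h h'
  have hinv : (s • (1 : Matrix ι ι R) - A)⁻¹ * Y = Y * (s • (1 : Matrix κ κ R) - A')⁻¹ := by
    calc _ = (s • (1 : Matrix ι ι R) - A)⁻¹ * (Y * (s • (1 : Matrix κ κ R) - A')) *
          (s • (1 : Matrix κ κ R) - A')⁻¹ := by
          rw [← Matrix.mul_assoc, Matrix.mul_nonsing_inv_cancel_right _ _ h']
      _ = _ := by rw [← hs, Matrix.nonsing_inv_mul_cancel_left _ _ h]
  rw [← hB, ← hC, Matrix.mul_assoc C, ← Matrix.mul_assoc _ Y, hinv]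
  simp only [Matrix.mul_assoc]

/-- The array with first row `1, 1, 0, 0, …` in which each row consists of the partial sums of the
previous one; its generating function in `p` is `(1 + w) (w / (1 - w)) ^ k`. -/
def partialSumArray : ℕ → ℕ → ℝ
  | 0, p => if p < 2 then 1 else 0
  | k + 1, p => ∑ q ∈ Finset.range p, partialSumArray k q

theorem partialSumArray_succ_zero (k : ℕ) : partialSumArray (k + 1) 0 = 0 := by
  simp [partialSumArray]

theorem partialSumArray_succ_succ (k p : ℕ) :
    partialSumArray (k + 1) (p + 1) = partialSumArray (k + 1) p + partialSumArray k p := by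
  simp [partialSumArray, Finset.sum_range_succ]

theorem partialSumArray_eq_zero {k p : ℕ} (h : p < k) : partialSumArray k p = 0 := by
  induction p generalizing k with
  | zero => obtain ⟨k, rfl⟩ := Nat.exists_eq_succ_of_ne_zero h.ne'
            exact partialSumArray_succ_zero k
  | succ p ih =>
    obtain ⟨k, rfl⟩ : ∃ j, k = j + 1 := ⟨k - 1, by omega⟩
    rw [partialSumArray_succ_succ, ih (by omega), ih (by omega), add_zero]

theorem partialSumArray_self (k : ℕ) : partialSumArray k k = 1 := by
  induction k with
  | zero => simp [partialSumArray]
  | succ k ih => rw [partialSumArray_succ_succ, partialSumArray_eq_zero (by omega), ih, zero_add]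

theorem partialSumArray_one {p : ℕ} (hp : 2 ≤ p) : partialSumArray 1 p = 2 := by
  induction p, hp using Nat.le_induction with
  | base =>
    rw [partialSumArray_succ_succ, partialSumArray_succ_succ, partialSumArray_succ_zero]
    norm_num [partialSumArray]
  | succ p hp ih =>
    rw [partialSumArray_succ_succ, ih]
    simp [partialSumArray, show ¬ p < 2 by omega]

theorem sum_neg_two_pow_mul_partialSumArray (m p : ℕ) (hp : p ≤ m) :
    ∑ k ∈ Finset.range (m + 1), (-2 : ℝ) ^ k * partialSumArray k p =
      if p = 0 then 1 else if p = 1 then -1 else 0 := by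
  induction p with
  | zero => simp [Finset.sum_range_succ', partialSumArray]
  | succ p ih =>
    have ih := ih (by omega)
    have htop : ∑ k ∈ Finset.range (m + 1), (-2 : ℝ) ^ k * partialSumArray k p =
        ∑ k ∈ Finset.range m, (-2 : ℝ) ^ k * partialSumArray k p := by
      rw [Finset.sum_range_succ, partialSumArray_eq_zero (by omega : p < m)]
      simp
    have hrec : ∑ k ∈ Finset.range m, (-2 : ℝ) ^ (k + 1) * partialSumArray (k + 1) (p + 1) =
        ∑ k ∈ Finset.range m, (-2 : ℝ) ^ (k + 1) * partialSumArray (k + 1) p -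
          2 * ∑ k ∈ Finset.range m, (-2 : ℝ) ^ k * partialSumArray k p := by
      rw [Finset.mul_sum, ← Finset.sum_sub_distrib]
      refine Finset.sum_congr rfl fun k _ => ?_
      rw [partialSumArray_succ_succ]
      ring
    have hbot := Finset.sum_range_succ' (fun k => (-2 : ℝ) ^ k * partialSumArray k p) m
    rw [Finset.sum_range_succ', hrec]
    simp only [partialSumArray, pow_zero, one_mul] at hbot ⊢
    rw [ih] at hbot htop
    rw [← htop]
    rcases p with _ | _ | p <;> simp at hbot ⊢ <;> linarith

theorem sum_output_mul_partialSumArray {M p : ℕ} (hM : 2 ≤ M) (hp : p < M) {c : ℕ → ℝ}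
    (hc1 : c 1 = 2) (hc2 : c 2 = 0)
    (hck : ∀ k, 3 ≤ k → k ≤ M → c k = (-1 : ℝ) ^ (k - 1) * 2 ^ (k - 2)) :
    ∑ k ∈ Finset.range M, c (k + 1) * partialSumArray k p = 2 := by
  obtain ⟨m, rfl⟩ : ∃ m, M = m + 2 := ⟨M - 2, by omega⟩
  have htail : ∑ k ∈ Finset.range m, c (k + 1 + 1 + 1) * partialSumArray (k + 1 + 1) p =
      1 / 2 * ∑ k ∈ Finset.range m, (-2 : ℝ) ^ (k + 1 + 1) * partialSumArray (k + 1 + 1) p := by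
    rw [Finset.mul_sum]
    refine Finset.sum_congr rfl fun k hk => ?_
    have hk := Finset.mem_range.1 hk
    rw [hck _ (by omega) (by omega), neg_pow (2 : ℝ)]
    simp only [Nat.add_sub_cancel, show k + 1 + 1 + 1 - 2 = k + 1 by omega]
    ring
  have hall := sum_neg_two_pow_mul_partialSumArray (m + 1) p (by omega)
  rw [Finset.sum_range_succ', Finset.sum_range_succ'] at hall ⊢
  rw [htail]
  rcases Nat.lt_or_ge p 2 with h | h
  · interval_cases p <;> simp [partialSumArray, hc1, hc2] at hall ⊢
  · simp [partialSumArray_one h, hc1, hc2, show p ≠ 0 by omega, show p ≠ 1 by omega,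
      show ¬ p < 2 by omega, partialSumArray.eq_1] at hall ⊢
    linarith

theorem input_eq_partialSumArray {K : ℕ} {b : ℕ → ℕ → ℝ} (hb21 : b 2 1 = 2) (hb22 : b 2 2 = 1)
    (hbk : ∀ k, 3 ≤ k → k ≤ K →
      b k 1 = 2 ∧ b k k = 1 ∧
        ∀ i, 2 ≤ i → i ≤ k - 1 → b k i = b (k - 1) (i - 1) + b (k - 1) i)
    {k : ℕ} (hk : 2 ≤ k) (hkK : k ≤ K) {i : ℕ} (hi : 1 ≤ i) (hik : i ≤ k) :
    b k i = partialSumArray i k := by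
  induction k, hk using Nat.le_induction generalizing i with
  | base =>
    obtain rfl | rfl : i = 1 ∨ i = 2 := by omega
    · rw [hb21, partialSumArray_one le_rfl]
    · rw [hb22, partialSumArray_self]
  | succ k hk ih =>
    obtain ⟨h1, h2, h3⟩ := hbk (k + 1) (by omega) hkK
    obtain rfl | hi' := hi.eq_or_lt
    · rw [h1, partialSumArray_one (by omega)]
    obtain rfl | hik' := hik.eq_or_lt
    · rw [h2, partialSumArray_self]
    obtain ⟨j, rfl⟩ : ∃ j, i = j + 1 := ⟨i - 1, by omega⟩
    rw [h3 _ (by omega) (by omega), partialSumArray_succ_succ]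
    simp only [Nat.add_sub_cancel]
    rw [ih (by omega) (by omega) (by omega), ih (by omega) (by omega) (by omega), add_comm]

/-- The top left `M × M` corner of `partialSumArray`. -/
def partialSumMatrix (M : ℕ) : Matrix (Fin M) (Fin M) ℝ :=
  Matrix.of fun k p => partialSumArray k p

theorem isUnit_det_partialSumMatrix (M : ℕ) : IsUnit (partialSumMatrix M).det := by
  have hupper : (partialSumMatrix M).BlockTriangular id := fun k p h =>
    partialSumArray_eq_zero h
  rw [Matrix.det_of_isUpperTriangular hupper]
  simp [partialSumMatrix, partialSumArray_self]

/-- The coupling `Γ` induces on vectors constant on consecutive pairs of nodes. -/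
def pairCoupling (M : ℕ) : Matrix (Fin M) (Fin M) ℝ :=
  Matrix.of fun q p => if q = p then 1 else if q < p then 2 else 0

theorem partialSumMatrix_mul_pairCoupling (M : ℕ) :
    partialSumMatrix M * pairCoupling M = Jmat M * partialSumMatrix M := by
  ext k p
  simp only [Matrix.mul_apply, partialSumMatrix, pairCoupling, Jmat, Matrix.of_apply]
  have hleft : ∑ q : Fin M, partialSumArray k q * (if q = p then 1 else if q < p then 2 else 0) =
      partialSumArray k p + 2 * partialSumArray (k + 1) p := by
    have hsplit : ∀ q : Fin M,
        partialSumArray k q * (if q = p then 1 else if q < p then 2 else 0) =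
          (if q = p then partialSumArray k q else 0) +
            2 * (if q.1 < p.1 then partialSumArray k q else 0) := by
      intro q
      have := @Fin.lt_def _ q p
      rcases lt_trichotomy q p with h | h | h
      · simp [h, h.ne, this.1 h, mul_comm]
      · simp [h]
      · simp [h.ne', h.not_gt]
    have hprefix : ∑ q : Fin M, (if q.1 < p.1 then partialSumArray k q else 0) =
        partialSumArray (k + 1) p := by
      rw [Fin.sum_univ_eq_sum_range (fun q => if q < p.1 then partialSumArray k q else 0) M,
        ← Finset.sum_filter, partialSumArray]
      refine Finset.sum_congr ?_ fun _ _ => rfl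
      ext q
      have := p.2
      simp only [Finset.mem_filter, Finset.mem_range]
      omega
    rw [Finset.sum_congr rfl fun q _ => hsplit q, Finset.sum_add_distrib, ← Finset.mul_sum,
      hprefix]
    simp
  have hright : ∑ j : Fin M,
      (if k = j then 1 else if j.1 = k.1 + 1 then 2 else 0) * partialSumArray j p =
        partialSumArray k p + 2 * partialSumArray (k + 1) p := by
    have hsplit : ∀ j : Fin M,
        (if k = j then 1 else if j.1 = k.1 + 1 then 2 else 0) * partialSumArray j p =
          (if k = j then partialSumArray j p else 0) +
            (if j.1 = k.1 + 1 then 2 * partialSumArray j p else 0) := by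
      intro j
      by_cases h : k = j
      · subst h; simp
      · simp [h]
    rw [Finset.sum_congr rfl fun j _ => hsplit j, Finset.sum_add_distrib,
      Fin.sum_univ_eq_sum_range
        (fun j => if j = k.1 + 1 then 2 * partialSumArray j p else 0) M]
    simp only [Finset.sum_ite_eq, Finset.sum_ite_eq', Finset.mem_univ, if_true, Finset.mem_range]
    split_ifs with h
    · rfl
    · rw [partialSumArray_eq_zero (by omega : p.1 < k.1 + 1), mul_zero]
  rw [hleft, hright]

/-- The `N × M` matrix duplicating every coordinate: row `i` is the unit row at `i / 2`. -/
def duplication (N M : ℕ) : Matrix (Fin N) (Fin M) ℝ :=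
  Matrix.of fun i q => if i.1 / 2 = q.1 then 1 else 0

theorem mul_duplication_apply {ι : Type*} {N M : ℕ} (h : N = 2 * M) (X : Matrix ι (Fin N) ℝ)
    (i : ι) (q : Fin M) :
    (X * duplication N M) i q = X i ⟨2 * q, by omega⟩ + X i ⟨2 * q + 1, by omega⟩ := by
  have hsplit : ∀ j : Fin N, X i j * duplication N M j q =
      (if j = ⟨2 * q, by omega⟩ then X i j else 0) +
        (if j = ⟨2 * q + 1, by omega⟩ then X i j else 0) := by
    intro j
    simp only [duplication, Matrix.of_apply, Fin.ext_iff]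
    split_ifs <;> first | omega | simp
  rw [Matrix.mul_apply, Finset.sum_congr rfl fun j _ => hsplit j, Finset.sum_add_distrib]
  simp

theorem duplication_mul_apply {κ : Type*} {N M : ℕ} (h : N = 2 * M) (X : Matrix (Fin M) κ ℝ)
    (i : Fin N) (k : κ) :
    (duplication N M * X) i k = X ⟨i / 2, by omega⟩ k := by
  have hsplit : ∀ q : Fin M, duplication N M i q * X q k =
      if q = ⟨i / 2, by omega⟩ then X q k else 0 := by
    intro q
    simp only [duplication, Matrix.of_apply, Fin.ext_iff, eq_comm (a := q.1)]
    split_ifs <;> simp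
  rw [Matrix.mul_apply, Finset.sum_congr rfl fun j _ => hsplit j]
  simp

theorem Gam_mul_duplication {N M : ℕ} (h : N = 2 * M) :
    Gam N * duplication N M = duplication N M * pairCoupling M := by
  ext i q
  rw [mul_duplication_apply h, duplication_mul_apply h]
  simp only [Gam, pairCoupling, Matrix.of_apply, Fin.ext_iff, Fin.lt_def]
  split_ifs <;> first | omega | norm_num

/-- The matrix intertwining `Γ` with `J_M`, the all-ones column with `b`, and the all-ones row
with `c`. -/
theorem exists_intertwining {N M : ℕ} (h : N = 2 * M) (hM : 2 ≤ M) {c : ℕ → ℝ} (hc1 : c 1 = 2)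
    (hc2 : c 2 = 0)
    (hck : ∀ k, 3 ≤ k → k ≤ M → c k = (-1 : ℝ) ^ (k - 1) * 2 ^ (k - 2))
    {b : ℕ → ℕ → ℝ} (hb21 : b 2 1 = 2) (hb22 : b 2 2 = 1)
    (hbk : ∀ k, 3 ≤ k → k ≤ M →
      b k 1 = 2 ∧ b k k = 1 ∧
        ∀ i, 2 ≤ i → i ≤ k - 1 → b k i = b (k - 1) (i - 1) + b (k - 1) i) :
    ∃ Y : Matrix (Fin N) (Fin M) ℝ, Gam N * Y = Y * Jmat M ∧
      Y * (Matrix.of fun (i : Fin M) (_ : Fin 1) => b M (i.1 + 1)) = Matrix.of (fun _ _ => 1) ∧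
      (Matrix.of fun (_ : Fin 1) (_ : Fin N) => (1 : ℝ)) * Y =
        Matrix.of fun (_ : Fin 1) (k : Fin M) => c (k.1 + 1) := by
  have hR := isUnit_det_partialSumMatrix M
  have hinput : (Matrix.of fun (i : Fin M) (_ : Fin 1) => b M (i.1 + 1)) =
      partialSumMatrix M * Matrix.of fun (_ : Fin M) (_ : Fin 1) => (1 : ℝ) := by
    ext i j
    simp only [Matrix.mul_apply, partialSumMatrix, Matrix.of_apply, mul_one]
    rw [input_eq_partialSumArray hb21 hb22 hbk hM le_rfl (by omega) (by omega), partialSumArray,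
      Fin.sum_univ_eq_sum_range (fun q => partialSumArray i q) M]
  have houtput : (Matrix.of fun (_ : Fin 1) (_ : Fin N) => (1 : ℝ)) * duplication N M =
      (Matrix.of fun (_ : Fin 1) (k : Fin M) => c (k.1 + 1)) * partialSumMatrix M := by
    ext i p
    rw [mul_duplication_apply h]
    simp only [Matrix.mul_apply, partialSumMatrix, Matrix.of_apply]
    rw [Fin.sum_univ_eq_sum_range (fun k => c (k + 1) * partialSumArray k p) M,
      sum_output_mul_partialSumArray hM p.2 hc1 hc2 hck]
    norm_num
  refine ⟨duplication N M * (partialSumMatrix M)⁻¹, ?_, ?_, ?_⟩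
  · have hconj : pairCoupling M * (partialSumMatrix M)⁻¹ = (partialSumMatrix M)⁻¹ * Jmat M := by
      calc _ = (partialSumMatrix M)⁻¹ * (partialSumMatrix M * pairCoupling M) *
            (partialSumMatrix M)⁻¹ := by rw [Matrix.nonsing_inv_mul_cancel_left _ _ hR]
        _ = _ := by
          rw [partialSumMatrix_mul_pairCoupling, ← Matrix.mul_assoc,
            Matrix.mul_nonsing_inv_cancel_right _ _ hR]
    rw [← Matrix.mul_assoc, Gam_mul_duplication h, Matrix.mul_assoc, hconj, Matrix.mul_assoc]
  · rw [hinput, Matrix.mul_assoc, Matrix.nonsing_inv_mul_cancel_left _ _ hR]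
    ext i j
    rw [duplication_mul_apply h]
    rfl
  · rw [← Matrix.mul_assoc, houtput, Matrix.mul_nonsing_inv_cancel_right _ _ hR]

/-- For even `N ≥ 4` and `M = N/2`, the full `N`-node network with coupling `Γ`,
column-input `E_N ⊗ B1` and row-output `E_Nᵀ ⊗ C1` has the same transfer function as the
reduced `M`-block system `Ã = I_M ⊗ A1 + J_M ⊗ A12`, `B̃` (blocks `b^{(M)}_i·B1`),
`C̃` (blocks `c_k·C1`), where `c_1 = 2`, `c_2 = 0`, `c_k = (−1)^{k−1}·2^{k−2}` for `k ≥ 3`,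
and `b^{(k)}` is defined recursively by `b^{(2)} = (2, 1)`, `b^{(k)}_1 = 2`, `b^{(k)}_k = 1`
and `b^{(k)}_i = b^{(k−1)}_{i−1} + b^{(k−1)}_i` for `2 ≤ i ≤ k−1`.
In particular the two systems have the same H₂ norm whenever they are stable.
(Note: `A12 = B1·C1` forces the input dimension `m` and output dimension `l` to coincide;
here both are `p`.) -/
theorem network_reduced_transfer_function (N n p : ℕ) (hN : 4 ≤ N) (hNe : Even N)
    (A1 : Matrix (Fin n) (Fin n) ℝ) (B1 : Matrix (Fin n) (Fin p) ℝ)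
    (C1 : Matrix (Fin p) (Fin n) ℝ)
    (c : ℕ → ℝ) (hc1 : c 1 = 2) (hc2 : c 2 = 0)
    (hck : ∀ k, 3 ≤ k → k ≤ N / 2 → c k = (-1 : ℝ) ^ (k - 1) * 2 ^ (k - 2))
    (b : ℕ → ℕ → ℝ) (hb21 : b 2 1 = 2) (hb22 : b 2 2 = 1)
    (hbk : ∀ k, 3 ≤ k → k ≤ N / 2 →
      b k 1 = 2 ∧ b k k = 1 ∧
        ∀ i, 2 ≤ i → i ≤ k - 1 → b k i = b (k - 1) (i - 1) + b (k - 1) i)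
    (EN : Matrix (Fin N) (Fin 1) ℝ) (hEN : EN = Matrix.of fun _ _ => 1)
    (A : Matrix (Fin N × Fin n) (Fin N × Fin n) ℝ)
    (hA : A = (1 : Matrix (Fin N) (Fin N) ℝ) ⊗ₖ A1 + Gam N ⊗ₖ (B1 * C1))
    (Atil : Matrix (Fin (N / 2) × Fin n) (Fin (N / 2) × Fin n) ℝ)
    (hAtil : Atil = (1 : Matrix (Fin (N / 2)) (Fin (N / 2)) ℝ) ⊗ₖ A1 + Jmat (N / 2) ⊗ₖ (B1 * C1))
    (Btil : Matrix (Fin (N / 2) × Fin n) (Fin 1 × Fin p) ℝ)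
    (hBtil : Btil = (Matrix.of fun (i : Fin (N / 2)) (_ : Fin 1) => b (N / 2) (i.1 + 1)) ⊗ₖ B1)
    (Ctil : Matrix (Fin 1 × Fin p) (Fin (N / 2) × Fin n) ℝ)
    (hCtil : Ctil = (Matrix.of fun (_ : Fin 1) (k : Fin (N / 2)) => c (k.1 + 1)) ⊗ₖ C1) :
    ∀ s : ℂ,
      IsUnit (s • (1 : Matrix (Fin N × Fin n) (Fin N × Fin n) ℂ) - A.map Complex.ofReal) →
      IsUnit (s • (1 : Matrix (Fin (N / 2) × Fin n) (Fin (N / 2) × Fin n) ℂ) -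
        Atil.map Complex.ofReal) →
      (EN.transpose ⊗ₖ C1).map Complex.ofReal *
          (s • (1 : Matrix (Fin N × Fin n) (Fin N × Fin n) ℂ) - A.map Complex.ofReal)⁻¹ *
          (EN ⊗ₖ B1).map Complex.ofReal =
        Ctil.map Complex.ofReal *
          (s • (1 : Matrix (Fin (N / 2) × Fin n) (Fin (N / 2) × Fin n) ℂ) -
            Atil.map Complex.ofReal)⁻¹ *
          Btil.map Complex.ofReal := by
  intro s h h'
  obtain ⟨Y, hY, hYb, hYc⟩ := exists_intertwining (N := N) (M := N / 2)
    (by obtain ⟨r, rfl⟩ := hNe; omega) (by omega) hc1 hc2 hck hb21 hb22 hbk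
  refine transfer_eq_of_intertwining (Y := (Y ⊗ₖ (1 : Matrix (Fin n) (Fin n) ℝ)).map
    Complex.ofRealHom) ?_ ?_ ?_ s h h'
  · change A.map Complex.ofRealHom * _ = _ * Atil.map Complex.ofRealHom
    rw [← Matrix.map_mul, ← Matrix.map_mul, hA, hAtil]
    simp only [Matrix.add_mul, Matrix.mul_add, ← Matrix.mul_kronecker_mul, hY, Matrix.one_mul,
      Matrix.mul_one]
  · change _ * Btil.map Complex.ofRealHom = (EN ⊗ₖ B1).map Complex.ofRealHom
    rw [← Matrix.map_mul, hBtil, ← Matrix.mul_kronecker_mul, hYb, hEN, Matrix.one_mul]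
  · change (EN.transpose ⊗ₖ C1).map Complex.ofRealHom * _ = Ctil.map Complex.ofRealHom
    rw [← Matrix.map_mul, hCtil, ← Matrix.mul_kronecker_mul, ← hYc, hEN, Matrix.mul_one]
    rfl
end
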